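/- arXiv:2407.09505 — 4 statements merged into one kernel-verified Lean document; each statement's English description precedes it below -/
import Mathlib

section
/- Let Ω be a closed subset of ℝⁿ with nonempty frontier ∂Ω and S_Ω its signed distance function. Fix m > 0 and let f : ℝⁿ → ℝ be 1-Lipschitz such that f(z) ≤ −m for every z with S_Ω(z) < −m. Assume the interior depth condition: for every p ∈ ∂Ω and every ε > 0 there exists z ∈ Ω with S_Ω(z) < −m and dist(p, z) ≤ m + ε. Then f(x) ≤ S_Ω(x) for every x ∉ Ω, i.e. f never overestimates the signed distance outside Ω. -/
open Metric Set
open scoped Classical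

/-- The signed distance function of a closed set `Ω`: `infDist x (frontier Ω)` outside `Ω`
and `-infDist x (frontier Ω)` on `Ω`. -/
noncomputable def sdf {n : ℕ} (Ω : Set (EuclideanSpace ℝ (Fin n)))
    (x : EuclideanSpace ℝ (Fin n)) : ℝ :=
  if x ∈ Ω then -infDist x (frontier Ω) else infDist x (frontier Ω)

/-- A `1`-Lipschitz `f` satisfying `f ≤ -m` on `{S_Ω < -m}`, under the
interior depth condition, never overestimates the signed distance outside `Ω`. -/
theorem lipschitz_no_overestimate_outside {n : ℕ} (Ω : Set (EuclideanSpace ℝ (Fin n)))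
    (hΩ : IsClosed Ω) (hfr : (frontier Ω).Nonempty)
    (m : ℝ) (hm : 0 < m)
    (f : EuclideanSpace ℝ (Fin n) → ℝ)
    (hf_lip : ∀ x z, |f x - f z| ≤ dist x z)
    (hf_le : ∀ z, sdf Ω z < -m → f z ≤ -m)
    (hdepth_in : ∀ p ∈ frontier Ω, ∀ ε > (0 : ℝ),
      ∃ z ∈ Ω, sdf Ω z < -m ∧ dist p z ≤ m + ε) :
    ∀ x, x ∉ Ω → f x ≤ sdf Ω x := by
  intro x hx
  rw [sdf, if_neg hx]
  refine (le_infDist hfr).2 fun p hp => le_of_forall_pos_le_add fun ε hε => ?_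
  obtain ⟨z, -, hz, hpz⟩ := hdepth_in p hp ε hε
  linarith [le_of_abs_le (hf_lip x z), hf_le z hz, dist_triangle x p z]
end

section
/- Let Ω be a closed subset of ℝⁿ with nonempty frontier ∂Ω and S_Ω its signed distance function. Fix m > 0 and let f : ℝⁿ → ℝ be 1-Lipschitz such that f(z) ≥ m for every z with S_Ω(z) > m. Assume the exterior depth condition: for every p ∈ ∂Ω and every ε > 0 there exists z ∉ Ω with S_Ω(z) > m and dist(p, z) ≤ m + ε. Then f(x) ≥ S_Ω(x) for every x ∈ Ω, i.e. f never underestimates below the (negative) signed distance inside Ω. -/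
open Metric Set
open scoped Classical

/-- A `1`-Lipschitz `f` satisfying `f ≥ m` on `{S_Ω > m}`, under the
exterior depth condition, never underestimates the signed distance inside `Ω`. -/
theorem lipschitz_no_underestimate_inside {n : ℕ} (Ω : Set (EuclideanSpace ℝ (Fin n)))
    (hΩ : IsClosed Ω) (hfr : (frontier Ω).Nonempty)
    (m : ℝ) (hm : 0 < m)
    (f : EuclideanSpace ℝ (Fin n) → ℝ)
    (hf_lip : ∀ x z, |f x - f z| ≤ dist x z)
    (hf_ge : ∀ z, m < sdf Ω z → m ≤ f z)
    (hdepth_out : ∀ p ∈ frontier Ω, ∀ ε > (0 : ℝ),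
      ∃ z ∉ Ω, m < sdf Ω z ∧ dist p z ≤ m + ε) :
    ∀ x ∈ Ω, sdf Ω x ≤ f x := by
  intro x hx
  rw [sdf, if_pos hx]
  refine le_of_forall_pos_le_add fun ε hε => ?_
  obtain ⟨p, hp, hxp⟩ := (infDist_lt_iff hfr).1
    (lt_add_of_pos_right (infDist x (frontier Ω)) (half_pos hε))
  obtain ⟨z, -, hz, hpz⟩ := hdepth_out p hp (ε / 2) (half_pos hε)
  linarith [hf_ge z hz, neg_le_of_abs_le (hf_lip x z), dist_triangle x p z]
end

section
/- Let Ω be a closed subset of ℝⁿ with nonempty frontier ∂Ω, S_Ω its signed distance function, y the occupancy label, m > 0, and U an open subset of {x : |S_Ω(x)| > m}. Let ρ : ℝⁿ → ℝ be nonnegative, bounded, measurable, with compact support, with ρ > 0 on U and ρ = 0 outside of the closure of U. Let f : ℝⁿ → ℝ be continuous with y(x) f(x) ≤ |S_Ω(x)| for all x ∈ U and ∫ −y(x) f(x) ρ(x) dx = ∫ −y(x) S_Ω(x) ρ(x) dx. Then f(x) = S_Ω(x) for every x ∈ U. -/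
open Metric Set MeasureTheory
open scoped Classical

/-- The occupancy label: `1` outside `Ω`, `-1` on `Ω`. -/
noncomputable def lbl {n : ℕ} (Ω : Set (EuclideanSpace ℝ (Fin n)))
    (x : EuclideanSpace ℝ (Fin n)) : ℝ :=
  if x ∈ Ω then -1 else 1

lemma abs_sdf {n : ℕ} (Ω : Set (EuclideanSpace ℝ (Fin n))) (x : EuclideanSpace ℝ (Fin n)) :
    |sdf Ω x| = infDist x (frontier Ω) := by
  unfold sdf
  split_ifs <;> simp [abs_of_nonneg infDist_nonneg]

lemma lbl_mul_sdf {n : ℕ} (Ω : Set (EuclideanSpace ℝ (Fin n))) (x : EuclideanSpace ℝ (Fin n)) :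
    lbl Ω x * sdf Ω x = infDist x (frontier Ω) := by
  unfold sdf lbl
  split_ifs <;> simp

lemma lbl_ne_zero {n : ℕ} (Ω : Set (EuclideanSpace ℝ (Fin n))) (x : EuclideanSpace ℝ (Fin n)) :
    lbl Ω x ≠ 0 := by
  unfold lbl
  split_ifs <;> simp

lemma abs_lbl {n : ℕ} (Ω : Set (EuclideanSpace ℝ (Fin n))) (x : EuclideanSpace ℝ (Fin n)) :
    |lbl Ω x| = 1 := by
  unfold lbl
  split_ifs <;> simp

lemma measurable_lbl {n : ℕ} {Ω : Set (EuclideanSpace ℝ (Fin n))} (hΩ : MeasurableSet Ω) :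
    Measurable (lbl Ω) :=
  Measurable.ite hΩ measurable_const measurable_const

/-- The occupancy label is continuous off the frontier. -/
lemma continuousAt_lbl {n : ℕ} {Ω : Set (EuclideanSpace ℝ (Fin n))}
    {x : EuclideanSpace ℝ (Fin n)} (hx : x ∉ frontier Ω) : ContinuousAt (lbl Ω) x := by
  rcases em (x ∈ Ω) with h | h
  · have hInt : x ∈ interior Ω := by
      by_contra hni
      exact hx ⟨subset_closure h, hni⟩
    refine continuousAt_const.congr (f := fun _ => -1) ?_
    filter_upwards [mem_interior_iff_mem_nhds.1 hInt] with z hz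
    simp [lbl, hz]
  · have hcl : x ∉ closure Ω := fun hc => hx ⟨hc, fun hi => h (interior_subset hi)⟩
    refine continuousAt_const.congr (f := fun _ => 1) ?_
    filter_upwards [isClosed_closure.isOpen_compl.mem_nhds hcl] with z hz
    have : z ∉ Ω := fun hzΩ => hz (subset_closure hzΩ)
    simp [lbl, this]

/-- A continuous function times a bounded compactly supported weight is integrable. -/
lemma Continuous.integrable_mul_of_hasCompactSupport {X : Type*} [TopologicalSpace X]
    [MeasurableSpace X] [BorelSpace X] {μ : Measure X}
    [IsFiniteMeasureOnCompacts μ] {u ρ : X → ℝ} (hu : Continuous u) {C : ℝ}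
    (hρC : ∀ x, |ρ x| ≤ C) (hρmeas : Measurable ρ) (hρsupp : HasCompactSupport ρ) :
    Integrable (fun x => u x * ρ x) μ := by
  have hsub : Function.support (fun x => u x * ρ x) ⊆ tsupport ρ :=
    (Function.support_mul_subset_right _ _).trans (subset_tsupport ρ)
  rw [← integrableOn_iff_integrable_of_support_subset hsub]
  have hInt : IntegrableOn u (tsupport ρ) μ :=
    hu.continuousOn.integrableOn_compact' hρsupp (isClosed_tsupport ρ).measurableSet
  exact hInt.mul_bdd (c := C) hρmeas.aestronglyMeasurable (Filter.Eventually.of_forall hρC)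

/-- If a continuous `f` satisfies `y · f ≤ |S_Ω|` on an open set `U`
where `ρ > 0` (and `ρ = 0` outside the closure of `U`), and its
Kantorovitch–Rubinstein loss equals that of `S_Ω`, then `f = S_Ω` on `U`. -/
theorem KR_equality_implies_eq {n : ℕ} (Ω : Set (EuclideanSpace ℝ (Fin n)))
    (hΩ : IsClosed Ω) (hfr : (frontier Ω).Nonempty)
    (m : ℝ) (hm : 0 < m)
    (U : Set (EuclideanSpace ℝ (Fin n))) (hUopen : IsOpen U)
    (hUsub : U ⊆ {x | m < |sdf Ω x|})
    (ρ : EuclideanSpace ℝ (Fin n) → ℝ)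
    (hρnn : ∀ x, 0 ≤ ρ x) (hρbdd : ∃ C : ℝ, ∀ x, ρ x ≤ C)
    (hρmeas : Measurable ρ) (hρsupp : HasCompactSupport ρ)
    (hρpos : ∀ x ∈ U, 0 < ρ x)
    (hρzero : ∀ x, x ∉ closure U → ρ x = 0)
    (f : EuclideanSpace ℝ (Fin n) → ℝ) (hf : Continuous f)
    (hf_le : ∀ x ∈ U, lbl Ω x * f x ≤ |sdf Ω x|)
    (heq : (∫ x, -lbl Ω x * f x * ρ x) = ∫ x, -lbl Ω x * sdf Ω x * ρ x) :
    ∀ x ∈ U, f x = sdf Ω x := by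
  obtain ⟨C, hC⟩ := hρbdd
  have hρC : ∀ x, |ρ x| ≤ C := fun x => by
    rw [abs_of_nonneg (hρnn x)]
    exact hC x
  set d : EuclideanSpace ℝ (Fin n) → ℝ := fun x => infDist x (frontier Ω) with hd
  have hdc : Continuous d := continuous_infDist_pt _
  have hm_le : ∀ x ∈ closure U, m ≤ d x := by
    refine closure_minimal (fun x hx => ?_) (isClosed_le continuous_const hdc)
    have := hUsub hx
    rw [Set.mem_ofPred_eq, abs_sdf] at this
    exact this.le
  have hlbl : ∀ x ∈ closure U, ContinuousAt (lbl Ω) x := fun x hx => by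
    refine continuousAt_lbl fun hxf => ?_
    have := hm_le x hx
    simp only [hd, infDist_zero_of_mem hxf] at this
    linarith
  set g : EuclideanSpace ℝ (Fin n) → ℝ := fun x => d x - lbl Ω x * f x with hg
  have hgc : ∀ x ∈ closure U, ContinuousAt g x := fun x hx =>
    hdc.continuousAt.sub ((hlbl x hx).mul hf.continuousAt)
  have hgU : ∀ x ∈ U, 0 ≤ g x := fun x hx => by
    have := hf_le x hx
    rw [abs_sdf] at this
    exact sub_nonneg.2 this
  have hgnn : ∀ x ∈ closure U, 0 ≤ g x := fun x hx => by
    have : (nhdsWithin x U).NeBot := mem_closure_iff_nhdsWithin_neBot.1 hx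
    exact ge_of_tendsto ((hgc x hx).mono_left nhdsWithin_le_nhds)
      (eventually_mem_nhdsWithin.mono hgU)
  have hgρ : ∀ x, 0 ≤ g x * ρ x := fun x => by
    by_cases hx : x ∈ closure U
    · exact mul_nonneg (hgnn x hx) (hρnn x)
    · simp [hρzero x hx]
  have hif : Integrable fun x => -lbl Ω x * f x * ρ x := by
    simp only [mul_assoc]
    exact (hf.integrable_mul_of_hasCompactSupport hρC hρmeas hρsupp).bdd_mul (c := 1)
      (measurable_lbl hΩ.measurableSet).neg.aestronglyMeasurable
      (Filter.Eventually.of_forall fun x => by rw [norm_neg, Real.norm_eq_abs, abs_lbl])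
  have his : Integrable fun x => -lbl Ω x * sdf Ω x * ρ x := by
    simp only [neg_mul, lbl_mul_sdf]
    exact (hdc.integrable_mul_of_hasCompactSupport hρC hρmeas hρsupp).neg
  have hdiff : (fun x => g x * ρ x) =
      fun x => -lbl Ω x * f x * ρ x - -lbl Ω x * sdf Ω x * ρ x := by
    funext x
    have hds : lbl Ω x * sdf Ω x = d x := lbl_mul_sdf Ω x
    simp only [hg]
    linear_combination -ρ x * hds
  have hInt : Integrable fun x => g x * ρ x := hdiff ▸ hif.sub his
  have hzero : ∫ x, g x * ρ x = 0 := by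
    rw [hdiff, integral_sub hif his, heq, sub_self]
  have hae : ∀ᵐ x, g x * ρ x = 0 := (integral_eq_zero_iff_of_nonneg hgρ hInt).1 hzero
  have hdense := Measure.dense_of_ae hae
  intro x hx
  have hgx : g x = 0 := by
    by_contra hne
    obtain ⟨z, hz, hzU, hzg⟩ := ((mem_closure_iff_frequently.1 (hdense x)).and_eventually
      ((hUopen.eventually_mem hx).and ((hgc x (subset_closure hx)).eventually_ne hne))).exists
    exact mul_ne_zero hzg (hρpos z hzU).ne' hz
  refine mul_left_cancel₀ (lbl_ne_zero Ω x) ?_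
  rw [lbl_mul_sdf]
  exact (sub_eq_zero.1 hgx).symm
end

section
/- Let k ≥ 1, W a real k × k matrix, b ∈ ℝᵏ, q ∈ ℝᵏ, and define the diagonal matrix T with entries T_ii = Σ_{j=1}^{k} |(WᵀW)_{ij}| · exp(q_j − q_i). Assume T_ii > 0 for every i. Let σ : ℝᵏ → ℝᵏ apply the ReLU function t ↦ max(0, t) componentwise. Then the SLL layer x ↦ x − 2 W T⁻¹ σ(Wᵀ x + b) is 1-Lipschitz from (ℝᵏ, ‖·‖₂) to (ℝᵏ, ‖·‖₂), where T⁻¹ is the diagonal matrix with entries 1/T_ii. -/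
open Matrix

/-- A quadratic form is bounded by the diagonal form of its rescaled absolute row sums. -/
theorem dotProduct_mulVec_le_sum_abs_mul_exp {ι : Type*} [Fintype ι] {A : Matrix ι ι ℝ}
    (hA : A.IsSymm) (q c : ι → ℝ) :
    c ⬝ᵥ A *ᵥ c ≤ ∑ i, (∑ j, |A i j| * Real.exp (q j - q i)) * c i ^ 2 := by
  set F : ι → ι → ℝ := fun i j => |A i j| * Real.exp (q j - q i) * c i ^ 2 with hF
  have key (i j : ι) : c i * (A i j * c j) ≤ (F i j + F j i) / 2 := by
    set e := Real.exp ((q j - q i) / 2)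
    set f := Real.exp ((q i - q j) / 2)
    have hef : e * f = 1 := by
      rw [← Real.exp_add, ← Real.exp_zero]
      ring_nf
    have he : Real.exp (q j - q i) = e ^ 2 := by
      rw [← Real.exp_nat_mul]
      ring_nf
    have hf : Real.exp (q i - q j) = f ^ 2 := by
      rw [← Real.exp_nat_mul]
      ring_nf
    calc c i * (A i j * c j) ≤ |A i j| * |c i * c j| := by
          rw [← abs_mul]
          exact (le_abs_self _).trans_eq (by ring_nf)
      _ = |A i j| * |(e * c i) * (f * c j)| := by
          rw [show e * c i * (f * c j) = (e * f) * (c i * c j) by ring, hef, one_mul]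
      _ ≤ |A i j| * (((e * c i) ^ 2 + (f * c j) ^ 2) / 2) := by
          gcongr
          rw [abs_le]
          constructor <;> nlinarith [sq_nonneg (e * c i + f * c j), sq_nonneg (e * c i - f * c j)]
      _ = (F i j + F j i) / 2 := by
          simp only [hF, hA.apply i j, he, hf]
          ring
  calc c ⬝ᵥ A *ᵥ c = ∑ i, ∑ j, c i * (A i j * c j) := by
        simp only [dotProduct, mulVec, Finset.mul_sum]
    _ ≤ ∑ i, ∑ j, (F i j + F j i) / 2 :=
        Finset.sum_le_sum fun i _ => Finset.sum_le_sum fun j _ => key i j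
    _ = (∑ i, ∑ j, F i j + ∑ i, ∑ j, F j i) / 2 := by
        simp only [← Finset.sum_div, Finset.sum_add_distrib]
    _ = ∑ i, ∑ j, F i j := by
        rw [Finset.sum_comm (f := fun i j => F j i)]
        ring
    _ = ∑ i, (∑ j, |A i j| * Real.exp (q j - q i)) * c i ^ 2 := by
        simp only [hF, Finset.sum_mul]

/-- The ReLU function is firmly nonexpansive. -/
theorem sq_max_zero_sub_le (s t : ℝ) :
    (max 0 s - max 0 t) ^ 2 ≤ (max 0 s - max 0 t) * (s - t) := by
  rcases max_cases 0 s with ⟨hs, hs'⟩ | ⟨hs, hs'⟩ <;>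
    rcases max_cases 0 t with ⟨ht, ht'⟩ | ⟨ht, ht'⟩ <;> rw [hs, ht] <;> nlinarith

/-- The SLL layer `x ↦ x - 2 W T⁻¹ σ(Wᵀ x + b)`, with `T` the diagonal
matrix `T_ii = Σ_j |(WᵀW)_ij| · exp(q_j - q_i)` (assumed positive) and `σ` the
componentwise ReLU, is `1`-Lipschitz for the Euclidean norm. -/
theorem sll_layer_one_lipschitz (k : ℕ) (hk : 1 ≤ k)
    (W : Matrix (Fin k) (Fin k) ℝ) (b q : Fin k → ℝ)
    (T : Fin k → ℝ)
    (hT : ∀ i, T i = ∑ j, |(Wᵀ * W) i j| * Real.exp (q j - q i))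
    (hTpos : ∀ i, 0 < T i)
    (g : EuclideanSpace ℝ (Fin k) → EuclideanSpace ℝ (Fin k))
    (hg : ∀ (x : EuclideanSpace ℝ (Fin k)) (i : Fin k),
      g x i = x i - 2 * ∑ j, W i j * (T j)⁻¹ * max 0 ((∑ l, W l j * x l) + b j)) :
    ∀ x z : EuclideanSpace ℝ (Fin k), ‖g x - g z‖ ≤ ‖x - z‖ := by
  intro x z
  set d : Fin k → ℝ := fun i => x i - z i with hd
  set s : Fin k → ℝ := fun j =>
    max 0 ((∑ l, W l j * x l) + b j) - max 0 ((∑ l, W l j * z l) + b j) with hs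
  set c : Fin k → ℝ := fun j => (T j)⁻¹ * s j with hc
  have hgd (i : Fin k) : (g x - g z) i = d i - 2 * (W *ᵥ c) i := by
    have hW : (W *ᵥ c) i = ∑ j, W i j * (T j)⁻¹ * max 0 ((∑ l, W l j * x l) + b j) -
        ∑ j, W i j * (T j)⁻¹ * max 0 ((∑ l, W l j * z l) + b j) := by
      rw [← Finset.sum_sub_distrib]
      simp only [mulVec, dotProduct]
      exact Finset.sum_congr rfl fun j _ => by simp only [hc, hs]; ring
    rw [PiLp.sub_apply, hg, hg, hW]
    simp only [hd]
    ring
  have hs_le (j : Fin k) : s j ^ 2 ≤ s j * (d ᵥ* W) j := by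
    have h : (d ᵥ* W) j = (∑ l, W l j * x l) + b j - ((∑ l, W l j * z l) + b j) := by
      rw [add_sub_add_right_eq_sub, ← Finset.sum_sub_distrib]
      simp only [vecMul, dotProduct]
      exact Finset.sum_congr rfl fun l _ => by simp only [hd]; ring
    rw [h]
    exact sq_max_zero_sub_le _ _
  have hquad : (W *ᵥ c) ⬝ᵥ (W *ᵥ c) ≤ d ⬝ᵥ W *ᵥ c := by
    calc (W *ᵥ c) ⬝ᵥ (W *ᵥ c) = c ⬝ᵥ (Wᵀ * W) *ᵥ c := by
          rw [← mulVec_mulVec, dotProduct_mulVec c, vecMul_transpose]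
      _ ≤ ∑ j, T j * c j ^ 2 := by
          simp only [hT]
          exact dotProduct_mulVec_le_sum_abs_mul_exp (isSymm_transpose_mul_self W) q c
      _ ≤ ∑ j, (d ᵥ* W) j * c j := by
          refine Finset.sum_le_sum fun j _ => ?_
          have hT0 := (hTpos j).ne'
          calc T j * c j ^ 2 = (T j)⁻¹ * s j ^ 2 := by
                simp only [hc]
                field_simp
            _ ≤ (T j)⁻¹ * (s j * (d ᵥ* W) j) :=
                mul_le_mul_of_nonneg_left (hs_le j) (inv_nonneg.2 (hTpos j).le)
            _ = (d ᵥ* W) j * c j := by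
                simp only [hc]
                ring
      _ = d ⬝ᵥ W *ᵥ c := (dotProduct_mulVec d W c).symm
  have hnorm : ‖g x - g z‖ ^ 2 =
      ‖x - z‖ ^ 2 - 4 * (d ⬝ᵥ W *ᵥ c) + 4 * ((W *ᵥ c) ⬝ᵥ (W *ᵥ c)) := by
    simp only [EuclideanSpace.real_norm_sq_eq, hgd, dotProduct, Finset.mul_sum,
      ← Finset.sum_sub_distrib, ← Finset.sum_add_distrib]
    exact Finset.sum_congr rfl fun i _ => by rw [PiLp.sub_apply]; ring
  exact le_of_sq_le_sq (by linarith) (norm_nonneg _)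
end
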